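/- Let G be a group with elements a₁, b, a₂, b₁, c satisfying the braid relations a₁ba₁ = ba₁b, a₂ba₂ = ba₂b, a₂b₁a₂ = b₁a₂b₁, b₁cb₁ = cb₁c, commutation for all other pairs among the five, and (a₁a₁a₂b)³ = c². Then (a₁a₁b)⁴ = (ccb₁)⁴. -/

import Mathlib

/-- In the three-strand braid group, the full twist is symmetric. -/
lemma full_twist_symm {G : Type*} [Group G] (x y : G) (h : x*y*x = y*x*y) :
    x*x*y*(x*x*y) = y*y*x*(y*y*x) := by
  calc x*x*y*(x*x*y) = x*(x*y*x)*(x*y) := by group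
    _ = x*(y*x*y)*(x*y) := by rw [h]
    _ = (x*y*x)*(y*x*y) := by simp only [mul_assoc]
    _ = (y*x*y)*(x*y*x) := by rw [h]
    _ = y*(x*y*x)*(y*x) := by group
    _ = y*y*x*(y*y*x) := by rw [h]; group

/-- The full twist commutes with the first generator. -/
lemma full_twist_comm {G : Type*} [Group G] (x y : G) (h : x*y*x = y*x*y) :
    Commute (x*x*y*(x*x*y)) x := by
  have e : x*x*y*(x*x*y) = (x*y*x)*(x*y*x) := by
    calc x*x*y*(x*x*y) = x*(x*y*x)*(x*y) := by group
      _ = x*(y*x*y)*(x*y) := by rw [h]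
      _ = (x*y*x)*(y*x*y) := by simp only [mul_assoc]
      _ = _ := by rw [h]
  have s1 : SemiconjBy (x*y*x) x y := by
    change x*y*x*x = y*(x*y*x)
    rw [h, mul_assoc, mul_assoc, ← mul_assoc x y x, h]
  have s2 : SemiconjBy (x*y*x) y x := by
    change x*y*x*y = x*(x*y*x)
    conv_rhs => rw [h]
    simp only [mul_assoc]
  rw [e]
  exact s2.mul_left s1

/-- Shifting a three-letter chain. -/
lemma chain_shift {G : Type*} [Group G] (x y t : G) (h : x*y*x = y*x*y)
    (c : x*t = t*x) : SemiconjBy (x*y*t) x y := by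
  change x*y*t*x = y*(x*y*t)
  calc x*y*t*x = x*y*(t*x) := by group
    _ = x*y*x*t := by rw [← c]; group
    _ = _ := by rw [h]; group

lemma chain_shift' {G : Type*} [Group G] (x y t : G) (h : y*t*y = t*y*t)
    (c : x*t = t*x) : SemiconjBy (x*y*t) y t := by
  change x*y*t*y = t*(x*y*t)
  calc x*y*t*y = x*(y*t*y) := by group
    _ = (x*t)*y*t := by rw [h]; group
    _ = _ := by rw [c]; group

theorem stmt_4 (G : Type*) [Group G] (a₁ b a₂ b₁ c : G)
    (h1 : a₁*b*a₁ = b*a₁*b) (h2 : a₂*b*a₂ = b*a₂*b)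
    (h3 : a₂*b₁*a₂ = b₁*a₂*b₁) (h4 : b₁*c*b₁ = c*b₁*c)
    (c1 : a₁*a₂ = a₂*a₁) (c2 : a₁*b₁ = b₁*a₁) (c3 : a₁*c = c*a₁)
    (c4 : b*b₁ = b₁*b) (c5 : b*c = c*b) (c6 : a₂*c = c*a₂)
    (star : (a₁*a₁*a₂*b)^3 = c^2) :
    (a₁*a₁*b)^4 = (c*c*b₁)^4 := by
  have C1 : Commute a₁ a₂ := c1
  have C2 : Commute a₁ b₁ := c2
  have C3 : Commute a₁ c := c3
  have C4 : Commute b b₁ := c4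
  have C5 : Commute b c := c5
  have C6 : Commute a₂ c := c6
  obtain ⟨z, hz⟩ : ∃ z, z = a₁*a₁*b*(a₁*a₁*b) := ⟨_, rfl⟩
  obtain ⟨w, hw⟩ : ∃ w, w = c*c*b₁*(c*c*b₁) := ⟨_, rfl⟩
  have hz' : z = b*b*a₁*(b*b*a₁) := hz.trans (full_twist_symm _ _ h1)
  have hw' : w = b₁*b₁*c*(b₁*b₁*c) := hw.trans (full_twist_symm _ _ h4.symm)
  have za : Commute z a₁ := hz ▸ full_twist_comm _ _ h1
  have zb : Commute z b := hz' ▸ full_twist_comm _ _ h1.symm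
  have wc : Commute w c := hw ▸ full_twist_comm _ _ h4.symm
  have wb : Commute w b₁ := hw' ▸ full_twist_comm _ _ h4
  have zt : ∀ t, Commute a₁ t → Commute b t → Commute z t := fun t p q => by
    rw [hz]; exact ((p.mul_left p).mul_left q).mul_left ((p.mul_left p).mul_left q)
  have wt : ∀ t, Commute c t → Commute b₁ t → Commute w t := fun t p q => by
    rw [hw]; exact ((p.mul_left p).mul_left q).mul_left ((p.mul_left p).mul_left q)
  have zb₁ := zt b₁ C2 C4
  have zc := zt c C3 C5
  have wa := wt a₁ C3.symm C2.symm
  have wb' := wt b C5.symm C4.symm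
  -- the star relation, rewritten
  have zz : b*a₁*a₁*(b*a₁*a₁) = z := by
    have k : a₁*a₁*(b*a₁*a₁*(b*a₁*a₁)) = z*(a₁*a₁) := by rw [hz]; group
    rw [(za.mul_right za).eq] at k
    exact mul_left_cancel k
  have st : c*c = a₂*b*a₁*a₁*b*a₂*z := by
    have k : (c*c)*(a₁*a₁) = (a₁*a₁)*((a₂*b*(a₁*a₁))^3) := by
      rw [← pow_two c, ← star]; simp only [pow_succ, pow_zero, one_mul, mul_assoc]
    have k2 : Commute (c*c) (a₁*a₁) :=
      (C3.symm.mul_left C3.symm).mul_right (C3.symm.mul_left C3.symm)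
    rw [k2.eq] at k
    have k3 := mul_left_cancel k
    have k4 : (a₁*a₁)*a₂ = a₂*(a₁*a₁) := (C1.mul_left C1).eq
    calc c*c = (a₂*b*(a₁*a₁))^3 := k3
      _ = a₂*b*(a₁*a₁)*(a₂*b)*((a₁*a₁)*a₂)*(b*(a₁*a₁)) := by
          simp only [pow_succ, pow_zero, one_mul, mul_assoc]
      _ = a₂*b*(a₁*a₁)*(a₂*b*a₂)*(a₁*a₁)*(b*(a₁*a₁)) := by
          rw [k4]; simp only [mul_assoc]
      _ = a₂*b*a₁*a₁*b*a₂*(b*a₁*a₁*(b*a₁*a₁)) := by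
          rw [h2]; simp only [mul_assoc]
      _ = _ := by rw [zz]
  -- the element h
  obtain ⟨h, hh⟩ : ∃ h, h = c*c*(b₁*(a₂*b*a₁*a₁*b*a₂)*b₁) := ⟨_, rfl⟩
  have hwz : w = h*z := by
    calc w = c*c*b₁*(c*c)*b₁ := by rw [hw]; simp only [mul_assoc]
      _ = c*c*b₁*(a₂*b*a₁*a₁*b*a₂)*(z*b₁) := by
          conv_lhs => rw [mul_assoc (c*c*b₁) (c*c) b₁]
          conv_lhs => enter [2, 1]; rw [st]
          simp only [mul_assoc]
      _ = _ := by rw [zb₁.eq, hh]; simp only [mul_assoc]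
  have hwz' : h = w*z⁻¹ := by rw [hwz]; group
  have ht : ∀ t, Commute w t → Commute z t → Commute h t := fun t p q => by
    rw [hwz']; exact p.mul_left q.inv_left
  have zz0 : Commute z z := Commute.refl z
  have hca := ht a₁ wa za
  have hcb := ht b wb' zb
  have hcb₁ := ht b₁ wb zb₁
  have hcc := ht c wc zc
  have hca₂ : Commute h a₂ := by
    rw [hh]
    refine (C6.symm.mul_left C6.symm).mul_left ?_
    have m : Commute (b*a₁*a₁*b) b₁ := ((C4.mul_left C2).mul_left C2).mul_left C4
    change b₁*(a₂*b*a₁*a₁*b*a₂)*b₁*a₂ = a₂*(b₁*(a₂*b*a₁*a₁*b*a₂)*b₁)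
    calc b₁*(a₂*b*a₁*a₁*b*a₂)*b₁*a₂ = b₁*a₂*(b*a₁*a₁*b)*(a₂*b₁*a₂) := by
          simp only [mul_assoc]
      _ = b₁*a₂*((b*a₁*a₁*b)*b₁)*(a₂*b₁) := by rw [h3]; simp only [mul_assoc]
      _ = (b₁*a₂*b₁)*(b*a₁*a₁*b)*(a₂*b₁) := by rw [m.eq]; simp only [mul_assoc]
      _ = _ := by rw [← h3]; simp only [mul_assoc]
  -- the block swap
  obtain ⟨T, hT⟩ : ∃ T, T = (a₂*b₁*c)*(b*a₂*b₁)*(a₁*b*a₂) := ⟨_, rfl⟩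
  have hT' : T = (a₂*b*a₁)*(b₁*a₂*b)*(c*b₁*a₂) := by
    calc T = a₂*b₁*(c*b)*a₂*(b₁*a₁)*b*a₂ := by rw [hT]; simp only [mul_assoc]
      _ = a₂*(b₁*b)*(c*a₂)*a₁*(b₁*b)*a₂ := by rw [← c5, ← c2]; simp only [mul_assoc]
      _ = a₂*b*b₁*(a₂*(c*a₁))*b*b₁*a₂ := by rw [← c4, ← c6]; simp only [mul_assoc]
      _ = a₂*b*b₁*(a₂*a₁)*(c*b)*b₁*a₂ := by rw [← c3]; simp only [mul_assoc]
      _ = a₂*b*(b₁*a₁)*a₂*b*c*b₁*a₂ := by rw [← c1, ← c5]; simp only [mul_assoc]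
      _ = _ := by rw [← c2]; simp only [mul_assoc]
  have T1 : SemiconjBy T a₁ b₁ := by
    rw [hT]
    exact ((chain_shift _ _ _ h3 c6).mul_left (chain_shift _ _ _ h2.symm c4)).mul_left
      (chain_shift _ _ _ h1 c1)
  have T2 : SemiconjBy T b c := by
    rw [hT]
    exact ((chain_shift' _ _ _ h4 c6).mul_left (chain_shift' _ _ _ h3 c4)).mul_left
      (chain_shift' _ _ _ h2.symm c1)
  have T3 : SemiconjBy T c b := by
    rw [hT']
    exact ((chain_shift _ _ _ h2 c1.symm).mul_left (chain_shift _ _ _ h3.symm c4.symm)).mul_left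
      (chain_shift _ _ _ h4.symm c6.symm)
  have T4 : SemiconjBy T b₁ a₁ := by
    rw [hT']
    exact ((chain_shift' _ _ _ h1.symm c1.symm).mul_left
      (chain_shift' _ _ _ h2 c4.symm)).mul_left (chain_shift' _ _ _ h3.symm c6.symm)
  have Tz : SemiconjBy T z w := by
    rw [hz, hw']
    have := (T1.mul_right T1).mul_right T2
    exact this.mul_right this
  have Tw : SemiconjBy T w z := by
    rw [hw, hz']
    have := (T3.mul_right T3).mul_right T4
    exact this.mul_right this
  have hTc : Commute h T := by
    rw [hT]
    exact (((hca₂.mul_right hcb₁).mul_right hcc).mul_right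
      ((hcb.mul_right hca₂).mul_right hcb₁)).mul_right ((hca.mul_right hcb).mul_right hca₂)
  have key : z = h*w := by
    have e : SemiconjBy T w (h*w) := by
      have := SemiconjBy.mul_right hTc.symm Tz
      rwa [← hwz] at this
    exact mul_right_cancel (Tw.eq.symm.trans e.eq)
  have hz2 : Commute h z := by
    rw [hz]
    exact ((hca.mul_right hca).mul_right hcb).mul_right ((hca.mul_right hca).mul_right hcb)
  calc (a₁*a₁*b)^4 = z*z := by rw [hz]; simp only [pow_succ, pow_zero, one_mul, mul_assoc]
    _ = z*(h*w) := by rw [← key]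
    _ = (h*z)*w := by rw [← mul_assoc, hz2.eq]
    _ = w*w := by rw [← hwz]
    _ = _ := by rw [hw]; simp only [pow_succ, pow_zero, one_mul, mul_assoc]
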